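/- arXiv:1903.05187 — 5 statements merged into one kernel-verified Lean document; each statement's English description precedes it below -/
import Mathlib

section
/- Let n, x, y, z, t be positive integers with 1 ≤ x < y < z < t < n/2. Then 𝔓₃(n,x) ∩ 𝔓₃(n,y) ∩ 𝔓₃(n,z) ∩ 𝔓₃(n,t) = ∅. -/
/-- The set of `k`-partitions of `n`: multisets of `k` positive integers summing to `n`. -/
def kPartitions (k n : ℕ) : Set (Multiset ℕ) :=
  {m | Multiset.card m = k ∧ (∀ x ∈ m, 0 < x) ∧ m.sum = n}

/-- The set of coprime `k`-partitions of `n`: `k`-partitions whose terms have gcd `1`. -/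
def kPartitionsCoprime (k n : ℕ) : Set (Multiset ℕ) :=
  {m | m ∈ kPartitions k n ∧ m.gcd = 1}

/-- The set of `k`-partitions of `n` with an `x`-cluster: some nonempty proper
subcollection of the terms sums to `x`. -/
def kPartitionsCluster (k n x : ℕ) : Set (Multiset ℕ) :=
  {m | m ∈ kPartitions k n ∧ ∃ s : Multiset ℕ, s ≤ m ∧ s ≠ 0 ∧ s ≠ m ∧ s.sum = x}

/-- A `3`-partition of `n` with an `x`-cluster has a term equal to `x` or to `n - x`. -/
theorem exists_mem_of_mem_kPartitionsCluster_three {n x : ℕ} {m : Multiset ℕ}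
    (h : m ∈ kPartitionsCluster 3 n x) : ∃ w ∈ m, w = x ∨ w + x = n := by
  obtain ⟨⟨hcard, -, hsum⟩, s, hs, hs0, hsm, rfl⟩ := h
  obtain ⟨u, rfl⟩ := Multiset.le_iff_exists_add.1 hs
  have hu0 : u ≠ 0 := by
    rintro rfl
    simp at hsm
  have hs_pos := Multiset.card_pos.2 hs0
  have hu_pos := Multiset.card_pos.2 hu0
  rw [Multiset.card_add] at hcard
  rw [Multiset.sum_add] at hsum
  obtain h1 | h1 : s.card = 1 ∨ u.card = 1 := by omega
  · obtain ⟨a, rfl⟩ := Multiset.card_eq_one.1 h1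
    exact ⟨a, by simp, by simp⟩
  · obtain ⟨a, rfl⟩ := Multiset.card_eq_one.1 h1
    refine ⟨a, by simp, Or.inr ?_⟩
    rw [Multiset.sum_singleton] at hsum
    omega

theorem cluster_inter_four (n x y z t : ℕ) (hx : 1 ≤ x) (hxy : x < y) (hyz : y < z)
    (hzt : z < t) (ht : 2 * t < n) :
    kPartitionsCluster 3 n x ∩ kPartitionsCluster 3 n y ∩ kPartitionsCluster 3 n z ∩
      kPartitionsCluster 3 n t = ∅ := by
  refine Set.eq_empty_of_forall_notMem ?_
  rintro m ⟨⟨⟨hmx, hmy⟩, hmz⟩, hmt⟩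
  obtain ⟨a, b, c, rfl⟩ := Multiset.card_eq_three.1 hmx.1.1
  obtain ⟨p, hp, hpx⟩ := exists_mem_of_mem_kPartitionsCluster_three hmx
  obtain ⟨q, hq, hqy⟩ := exists_mem_of_mem_kPartitionsCluster_three hmy
  obtain ⟨r, hr, hrz⟩ := exists_mem_of_mem_kPartitionsCluster_three hmz
  obtain ⟨s, hs, hst⟩ := exists_mem_of_mem_kPartitionsCluster_three hmt
  simp only [Multiset.insert_eq_cons, Multiset.mem_cons, Multiset.mem_singleton] at hp hq hr hs
  have hpq : p ≠ q := by omega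
  have hpr : p ≠ r := by omega
  have hps : p ≠ s := by omega
  have hqr : q ≠ r := by omega
  have hqs : q ≠ s := by omega
  have hrs : r ≠ s := by omega
  clear hpx hqy hrz hst
  grind
end

section
/- Let n ≥ 3 and ℓ ≥ 1 be natural numbers, and let x₁, …, x_ℓ be pairwise distinct positive integers with 1 ≤ xᵢ < n/2 for each i. Then |⋃_{i=1}^{ℓ} 𝔓₃(n, xᵢ)| ≤ (ℓ/2)·(n − ℓ + 1). Equivalently, the number of 3-partitions of n covered by ℓ intransitive maximal subgroups P_{x₁}, …, P_{x_ℓ} of Sym(n) is at most (ℓ/2)·(n − ℓ + 1). -/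
/-- A set of integers strictly between `0` and `m` meets at least half as many of the unordered
pairs `{a, m - a}` as it has elements. -/
lemma two_mul_card_filter_avoiding_pairs_le (m : ℕ) (X : Finset ℕ)
    (hX : ∀ x ∈ X, 1 ≤ x ∧ x < m) :
    2 * ((Finset.Icc 1 (m / 2)).filter fun a => a ∉ X ∧ m - a ∉ X).card + X.card ≤ m := by
  have hfiber : X.card ≤ 2 * (X.image fun x => min x (m - x)).card := by
    refine Finset.card_le_mul_card_image X 2 fun b _ => ?_
    refine (Finset.card_le_card (t := {b, m - b}) fun x hx => ?_).trans Finset.card_le_two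
    have h := hX x (Finset.mem_filter.1 hx).1
    have hb := (Finset.mem_filter.1 hx).2
    simp only [Finset.mem_insert, Finset.mem_singleton]
    omega
  have hdisj : Disjoint ((Finset.Icc 1 (m / 2)).filter fun a => a ∉ X ∧ m - a ∉ X)
      (X.image fun x => min x (m - x)) := by
    rw [Finset.disjoint_left]
    intro a ha ha'
    obtain ⟨x, hx, rfl⟩ := Finset.mem_image.1 ha'
    obtain ⟨-, h₁, h₂⟩ := Finset.mem_filter.1 ha
    have h := hX x hx
    rcases le_total x (m - x) with hle | hle
    · rw [min_eq_left hle] at h₁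
      exact h₁ hx
    · rw [min_eq_right hle, Nat.sub_sub_self h.2.le] at h₂
      exact h₂ hx
  have hsub : ((Finset.Icc 1 (m / 2)).filter fun a => a ∉ X ∧ m - a ∉ X) ∪
      (X.image fun x => min x (m - x)) ⊆ Finset.Icc 1 (m / 2) := by
    refine Finset.union_subset (Finset.filter_subset _ _) fun a ha => ?_
    obtain ⟨x, hx, rfl⟩ := Finset.mem_image.1 ha
    have h := hX x hx
    rw [Finset.mem_Icc]
    omega
  have hcard := Finset.card_le_card hsub
  rw [Finset.card_union_of_disjoint hdisj, Nat.card_Icc] at hcard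
  omega

/-- A `3`-partition with an `x`-cluster has `x` or `n - x` among its terms. -/
lemma exists_of_mem_kPartitionsCluster_three {n x : ℕ} {m : Multiset ℕ}
    (hm : m ∈ kPartitionsCluster 3 n x) :
    ∃ a b c, 1 ≤ a ∧ a ≤ b ∧ m = {c, a, b} ∧ a + b + c = n ∧ (c = x ∨ c = n - x) := by
  obtain ⟨⟨hcard, hpos, hsum⟩, s, hs, hs₀, hsm, hsx⟩ := hm
  obtain ⟨t, rfl⟩ := Multiset.le_iff_exists_add.1 hs
  have key : ∀ {u v : Multiset ℕ}, u.card = 1 → v.card = 2 → u + v = s + t →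
      ∃ a b, 1 ≤ a ∧ a ≤ b ∧ s + t = {u.sum, a, b} ∧ a + b + u.sum = n := by
    intro u v hu hv huv
    obtain ⟨c, rfl⟩ := Multiset.card_eq_one.1 hu
    obtain ⟨a, b, rfl⟩ := Multiset.card_eq_two.1 hv
    rw [← huv] at hpos hsum ⊢
    have ha : 0 < a := hpos a (by simp)
    have hb : 0 < b := hpos b (by simp)
    simp only [Multiset.insert_eq_cons, Multiset.sum_add, Multiset.sum_cons,
      Multiset.sum_singleton] at hsum ⊢
    rcases le_total a b with hab | hab
    · exact ⟨a, b, ha, hab, Multiset.singleton_add _ _, by omega⟩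
    · exact ⟨b, a, hb, hab, congrArg (c ::ₘ ·) (Multiset.pair_comm a b), by omega⟩
  have hs₁ : 0 < s.card := Multiset.card_pos.2 hs₀
  have ht₁ : 0 < t.card := Multiset.card_pos.2 fun h => hsm (by simp [h])
  rw [Multiset.card_add] at hcard
  rw [Multiset.sum_add] at hsum
  obtain hc | hc : s.card = 1 ∨ t.card = 1 := by omega
  · obtain ⟨a, b, ha, hab, h, habc⟩ := key hc (by omega) rfl
    exact ⟨a, b, s.sum, ha, hab, h, habc, Or.inl hsx⟩
  · obtain ⟨a, b, ha, hab, h, habc⟩ := key hc (by omega) (add_comm t s)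
    exact ⟨a, b, t.sum, ha, hab, h, habc, Or.inr (by omega)⟩

lemma mem_kPartitionsCluster_of_mem {k n x : ℕ} (hk : 2 ≤ k) {m : Multiset ℕ}
    (hm : m ∈ kPartitions k n) (hx : x ∈ m) : m ∈ kPartitionsCluster k n x := by
  refine ⟨hm, {x}, Multiset.singleton_le.2 hx, Multiset.singleton_ne_zero x, ?_, by simp⟩
  rintro rfl
  have h := hm.1
  rw [Multiset.card_singleton] at h
  omega

/-- The `3`-partitions with an `x`-cluster for some `x ∈ X` lie in a finset of size at most
`|X| * (n - |X| + 1) / 2`. -/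
lemma exists_finset_superset_kPartitionsCluster_three (n : ℕ) (X : Finset ℕ)
    (hX : ∀ x ∈ X, 1 ≤ x ∧ 2 * x < n) :
    ∃ F : Finset (Multiset ℕ), (∀ x ∈ X, kPartitionsCluster 3 n x ⊆ F) ∧
      2 * F.card + X.card * X.card ≤ X.card * (n + 1) := by
  induction X using Finset.induction_on_max with
  | empty => exact ⟨∅, by simp, by simp⟩
  | insert y X hmax ih =>
    obtain ⟨F, hF, hcard⟩ := ih fun x hx => hX x (Finset.mem_insert_of_mem hx)
    have hy := hX y (Finset.mem_insert_self y X)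
    have hyX : y ∉ X := fun h => lt_irrefl y (hmax y h)
    have hX' : ∀ x ∈ X, 1 ≤ x := fun x hx => (hX x (Finset.mem_insert_of_mem hx)).1
    let G : ℕ → Finset ℕ := fun c =>
      (Finset.Icc 1 ((n - c) / 2)).filter fun a => a ∉ X ∧ n - c - a ∉ X
    let f : ℕ → ℕ → Multiset ℕ := fun c a => {c, a, n - c - a}
    refine ⟨F ∪ ((G y).image (f y) ∪ (G (n - y)).image (f (n - y))), ?_, ?_⟩
    · intro x hx
      obtain rfl | hx := Finset.mem_insert.1 hx
      · intro m hm
        by_cases hmF : m ∈ F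
        · simp [hmF]
        have hnot : ∀ z ∈ X, z ∉ m := fun z hz hzm =>
          hmF (hF z hz (mem_kPartitionsCluster_of_mem (by norm_num) hm.1 hzm))
        obtain ⟨a, b, c, ha, hab, rfl, hsum, hc⟩ := exists_of_mem_kPartitionsCluster_three hm
        obtain rfl : b = n - c - a := by omega
        have hmem : ({c, a, n - c - a} : Multiset ℕ) ∈ (G c).image (f c) := by
          refine Finset.mem_image.2 ⟨a, Finset.mem_filter.2 ⟨?_, ?_, ?_⟩, rfl⟩
          · rw [Finset.mem_Icc]
            omega
          · exact fun h => hnot _ h (by simp)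
          · exact fun h => hnot _ h (by simp)
        rw [Finset.mem_coe, Finset.mem_union, Finset.mem_union]
        rcases hc with rfl | rfl
        · exact Or.inr (Or.inl hmem)
        · exact Or.inr (Or.inr hmem)
      · exact (hF x hx).trans (Finset.coe_subset.2 Finset.subset_union_left)
    · have h₁ : 2 * (G y).card + X.card ≤ n - y :=
        two_mul_card_filter_avoiding_pairs_le (n - y) X fun x hx =>
          ⟨hX' x hx, by have := hmax x hx; omega⟩
      have h₂ : 2 * (G (n - y)).card + X.card ≤ n - (n - y) :=
        two_mul_card_filter_avoiding_pairs_le (n - (n - y)) X fun x hx =>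
          ⟨hX' x hx, by have := hmax x hx; omega⟩
      have h₃ := Finset.card_union_le F
        ((G y).image (f y) ∪ (G (n - y)).image (f (n - y)))
      have h₄ := Finset.card_union_le ((G y).image (f y)) ((G (n - y)).image (f (n - y)))
      have h₅ := Finset.card_image_le (s := G y) (f := f y)
      have h₆ := Finset.card_image_le (s := G (n - y)) (f := f (n - y))
      have h₇ : n - y + (n - (n - y)) = n := by omega
      rw [Finset.card_insert_of_notMem hyX]
      linarith

theorem cluster_union_count_le (n ℓ : ℕ) (hn : 3 ≤ n) (hℓ : 1 ≤ ℓ) (x : Fin ℓ → ℕ)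
    (hinj : Function.Injective x) (hx₁ : ∀ i, 1 ≤ x i) (hx₂ : ∀ i, 2 * x i < n) :
    ((⋃ i : Fin ℓ, kPartitionsCluster 3 n (x i)).ncard : ℝ) ≤
      ((ℓ : ℝ) / 2) * ((n : ℝ) - (ℓ : ℝ) + 1) := by
  obtain ⟨F, hF, hcard⟩ := exists_finset_superset_kPartitionsCluster_three n
    (Finset.univ.image x) (by simpa using fun i => ⟨hx₁ i, hx₂ i⟩)
  rw [Finset.card_image_of_injective _ hinj, Finset.card_univ, Fintype.card_fin] at hcard
  have hle : (⋃ i : Fin ℓ, kPartitionsCluster 3 n (x i)).ncard ≤ F.card := by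
    rw [← Set.ncard_coe_finset]
    exact Set.ncard_le_ncard (Set.iUnion_subset fun i => hF _ (by simp)) F.finite_toSet
  have hle' : ((⋃ i : Fin ℓ, kPartitionsCluster 3 n (x i)).ncard : ℝ) ≤ F.card := by
    exact_mod_cast hle
  have hcard' : 2 * (F.card : ℝ) + ℓ * ℓ ≤ ℓ * (n + 1) := by exact_mod_cast hcard
  linarith
end

section
/- Let n ≥ 3 be a natural number and let Q(n) := {(q,d) ∈ ℕ² : n = (q^d − 1)/(q − 1), q a prime power, d ≥ 2}. Then |Q(n)| ≤ ω(n−1), where ω(m) denotes the number of distinct prime divisors of m. -/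
/-- `Q(n)` is the set of pairs `(q, d)` with `q` a prime power, `d ≥ 2` and
`n = (q^d − 1)/(q − 1)`. -/
def Qset (n : ℕ) : Set (ℕ × ℕ) :=
  {p | IsPrimePow p.1 ∧ 2 ≤ p.2 ∧ n = (p.1 ^ p.2 - 1) / (p.1 - 1)}

theorem eq_geom_sum_of_mem_Qset {n : ℕ} {x : ℕ × ℕ} (hx : x ∈ Qset n) :
    n = ∑ i ∈ Finset.range x.2, x.1 ^ i := by
  rw [Nat.geomSum_eq hx.1.two_le]
  exact hx.2.2

theorem exists_coprime_mul_of_mem_Qset {n : ℕ} {x : ℕ × ℕ} (hx : x ∈ Qset n) :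
    ∃ m, m ≠ 0 ∧ Nat.Coprime x.1 m ∧ n - 1 = x.1 * m := by
  have hsum := eq_geom_sum_of_mem_Qset hx
  obtain ⟨e, he⟩ := Nat.exists_eq_add_of_le' hx.2.1
  rw [he, geom_sum_succ] at hsum
  refine ⟨∑ i ∈ Finset.range (e + 1), x.1 ^ i, ?_, ?_, by omega⟩
  · rw [geom_sum_succ]
    omega
  · rw [geom_sum_succ]
    simp

theorem ordProj_minFac_of_mem_Qset {n : ℕ} {x : ℕ × ℕ} (hx : x ∈ Qset n) :
    x.1.minFac ^ (n - 1).factorization x.1.minFac = x.1 := by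
  obtain ⟨m, hm, hcop, hmul⟩ := exists_coprime_mul_of_mem_Qset hx
  have hndvd : ¬ x.1.minFac ∣ m := fun h =>
    hx.1.ne_one (Nat.minFac_eq_one_iff.1
      (Nat.eq_one_of_dvd_coprimes hcop (Nat.minFac_dvd _) h))
  rw [hmul, Nat.factorization_mul hx.1.ne_zero hm, Finsupp.add_apply,
    Nat.factorization_eq_zero_of_not_dvd hndvd, add_zero]
  exact hx.1.minFac_pow_factorization_eq

theorem minFac_mem_primeFactors_of_mem_Qset {n : ℕ} {x : ℕ × ℕ} (hx : x ∈ Qset n) :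
    x.1.minFac ∈ (n - 1).primeFactors := by
  obtain ⟨m, hm, -, hmul⟩ := exists_coprime_mul_of_mem_Qset hx
  rw [hmul]
  exact Nat.mem_primeFactors.2 ⟨Nat.minFac_prime hx.1.ne_one,
    (Nat.minFac_dvd _).mul_right _, mul_ne_zero hx.1.ne_zero hm⟩

theorem injOn_minFac_Qset (n : ℕ) :
    Set.InjOn (fun x : ℕ × ℕ => x.1.minFac) (Qset n) := by
  intro x hx y hy hxy
  have hfst : x.1 = y.1 := by
    rw [← ordProj_minFac_of_mem_Qset hx, ← ordProj_minFac_of_mem_Qset hy]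
    simp only at hxy
    rw [hxy]
  refine Prod.ext hfst ?_
  have hsum := (eq_geom_sum_of_mem_Qset hx).symm.trans (eq_geom_sum_of_mem_Qset hy)
  rw [← hfst] at hsum
  have hmono : StrictMono fun d => ∑ i ∈ Finset.range d, x.1 ^ i :=
    strictMono_nat_of_lt_succ fun d => by
      rw [Finset.sum_range_succ]
      exact Nat.lt_add_of_pos_right (pow_pos hx.1.pos d)
  exact hmono.injective hsum

theorem Qset_ncard_le_omega (n : ℕ) (hn : 3 ≤ n) :
    (Qset n).ncard ≤ (n - 1).primeFactors.card := by
  rw [← Set.ncard_coe_finset]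
  exact Set.ncard_le_ncard_of_injOn _ (fun _ hx => minFac_mem_primeFactors_of_mem_Qset hx)
    (injOn_minFac_Qset n) (Finset.finite_toSet _)
end

section
/- Let n ≥ 3 be a natural number and let Q(n) := {(q,d) ∈ ℕ² : n = (q^d − 1)/(q − 1), q a prime power, d ≥ 2}. If (q,2) ∈ Q(n) for some prime power q, then |Q(n)| = 1. -/
theorem eq_zero_of_isPrimePow_geomSum {r k : ℕ} (hr : r ≠ 1)
    (h : IsPrimePow (r * ∑ i ∈ Finset.range k, r ^ (i + 1) + r)) : k = 0 := by
  obtain ⟨p, a, hp, -, hpa⟩ := h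
  have hp' : p.Prime := hp.nat_prime
  set T := ∑ i ∈ Finset.range k, r ^ (i + 1)
  have hfac : p ^ a = r * (T + 1) := by rw [hpa]; ring
  have hrT : r ∣ T := Finset.dvd_sum fun i _ => dvd_pow_self r i.succ_ne_zero
  obtain ⟨b, -, hb⟩ := (Nat.dvd_prime_pow hp').1 (Dvd.intro _ hfac.symm)
  obtain ⟨c, -, hc⟩ := (Nat.dvd_prime_pow hp').1 (Dvd.intro_left _ hfac.symm)
  have hb0 : b ≠ 0 := by rintro rfl; exact hr (by simpa using hb)
  have hpr : p ∣ r := hb ▸ dvd_pow_self p hb0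
  have hc0 : c = 0 := by
    by_contra hc0
    have hd : p ∣ T + 1 := hc ▸ dvd_pow_self p hc0
    exact hp'.one_lt.ne' (Nat.dvd_one.1 ((Nat.dvd_add_right (hpr.trans hrT)).1 hd))
  have hT0 : T = 0 := by simpa [hc0] using hc
  by_contra hk
  have h0 := (Finset.sum_eq_zero_iff.1 hT0) 0 (Finset.mem_range.2 (Nat.pos_of_ne_zero hk))
  have hr0 : r = 0 := by simpa using h0
  simp [hr0, hp'.ne_zero] at hfac

theorem Qset_ncard_eq_one (n : ℕ) (hn : 3 ≤ n) (q : ℕ) (h : (q, 2) ∈ Qset n) :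
    (Qset n).ncard = 1 := by
  obtain ⟨hq, -, hnq⟩ := id h
  rw [← Nat.geomSum_eq hq.two_le] at hnq
  rw [Set.ncard_eq_one]
  refine ⟨(q, 2), Set.eq_singleton_iff_unique_mem.2 ⟨h, ?_⟩⟩
  rintro ⟨r, d⟩ ⟨hr, hd, hnr⟩
  dsimp only at hr hd hnr hq hnq
  rw [← Nat.geomSum_eq hr.two_le] at hnr
  obtain ⟨k, rfl⟩ := Nat.exists_eq_add_of_le' hd
  have hqr : q = r * ∑ i ∈ Finset.range k, r ^ (i + 1) + r := by
    rw [Finset.sum_range_succ', Finset.sum_range_succ'] at hnr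
    simp only [zero_add, pow_one, pow_zero] at hnr
    rw [geom_sum_two] at hnq
    rw [Finset.mul_sum]
    simp only [← pow_succ']
    omega
  obtain rfl := eq_zero_of_isPrimePow_geomSum hr.one_lt.ne' (hqr ▸ hq)
  simp [hqr]
end

section
/- Let n ≥ 3 be a natural number which is not prime. Then γ(Sym(n)) ≤ n/3 + φ(n)/2 + ω(n), where φ is Euler's totient function and ω(n) is the number of distinct prime divisors of n. -/
/-- The normal covering number of a group `G`: the least `s` such that there exist
proper subgroups `H₁, …, H_s` of `G` with every element of `G` lying in some
conjugate of some `Hᵢ`. -/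
noncomputable def normalCoveringNumber (G : Type*) [Group G] : ℕ :=
  sInf {s : ℕ | ∃ H : Fin s → Subgroup G, (∀ i, H i ≠ ⊤) ∧
    ∀ g : G, ∃ i : Fin s, ∃ x : G, x * g * x⁻¹ ∈ H i}

open MulAction Equiv.Perm
open scoped Pointwise

theorem normalCoveringNumber_le_card {G ι : Type*} [Group G] [Fintype ι]
    (H : ι → Subgroup G) (hH : ∀ i, H i ≠ ⊤)
    (hcov : ∀ g : G, ∃ i, ∃ x : G, x * g * x⁻¹ ∈ H i) :
    normalCoveringNumber G ≤ Fintype.card ι := by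
  let e := Fintype.equivFin ι
  refine Nat.sInf_le ⟨fun j => H (e.symm j), fun j => hH _, fun g => ?_⟩
  obtain ⟨i, x, hx⟩ := hcov g
  exact ⟨e i, x, by simpa using hx⟩

/-- The permutations which translate the labelling `r` by a constant. -/
def translationSubgroup {α A : Type*} [AddCommGroup A] (r : α → A) :
    Subgroup (Equiv.Perm α) where
  carrier := {g | ∃ c : A, ∀ a, r (g a) = r a + c}
  one_mem' := ⟨0, by simp⟩
  mul_mem' := by
    rintro g h ⟨c, hc⟩ ⟨d, hd⟩
    exact ⟨d + c, fun a => by simp [hc, hd, add_assoc]⟩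
  inv_mem' := by
    rintro g ⟨c, hc⟩
    refine ⟨-c, fun a => ?_⟩
    have := hc (g⁻¹ a)
    rw [coe_inv, Equiv.apply_symm_apply] at this
    rw [coe_inv, this, add_neg_cancel_right]

theorem mem_translationSubgroup {α A : Type*} [AddCommGroup A] {r : α → A}
    {g : Equiv.Perm α} :
    g ∈ translationSubgroup r ↔ ∃ c : A, ∀ a, r (g a) = r a + c := Iff.rfl

theorem translationSubgroup_ne_top {α A : Type*} [AddCommGroup A] {r : α → A}
    {a b c : α} (hab : r a ≠ r b) (hca : c ≠ a) (hcb : c ≠ b) :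
    translationSubgroup r ≠ ⊤ := by
  classical
  intro h
  obtain ⟨d, hd⟩ := mem_translationSubgroup.1 (h ▸ Subgroup.mem_top (Equiv.swap a b))
  have h1 := hd c
  have h2 := hd a
  rw [Equiv.swap_apply_of_ne_of_ne hca hcb, left_eq_add] at h1
  rw [Equiv.swap_apply_left, h1, add_zero] at h2
  exact hab h2.symm

theorem mul_card_fiber_of_shift {α : Type*} [Finite α] {p : ℕ} [NeZero p]
    (f : α → ZMod p) (σ : Equiv.Perm α) (hσ : ∀ a, f (σ a) = f a + 1) (c : ZMod p) :
    p * Nat.card {a // f a = c} = Nat.card α := by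
  have step (d : ZMod p) : Nat.card {a // f a = d + 1} = Nat.card {a // f a = d} :=
    (Nat.card_congr (σ.subtypeEquiv fun a => by simp [hσ])).symm
  have const (d : ZMod p) : Nat.card {a // f a = d} = Nat.card {a // f a = 0} := by
    rw [← ZMod.natCast_zmod_val d]
    induction d.val with
    | zero => simp
    | succ k ih => rw [Nat.cast_succ, step, ih]
  rw [← Nat.card_congr (Equiv.sigmaFiberEquiv f), Nat.card_sigma]
  simp [const, ZMod.card]

/-- Two labellings, each shifted by one under some permutation, differ by a permutation. -/
theorem exists_perm_comp_eq {α : Type*} [Finite α] {p : ℕ} [NeZero p]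
    (f r : α → ZMod p) (σ τ : Equiv.Perm α) (hf : ∀ a, f (σ a) = f a + 1)
    (hr : ∀ a, r (τ a) = r a + 1) :
    ∃ x : Equiv.Perm α, ∀ a, r (x a) = f a := by
  have e (c : ZMod p) : {a // f a = c} ≃ {a // r a = c} :=
    Nonempty.some <| Finite.card_eq.1 <| Nat.eq_of_mul_eq_mul_left (NeZero.pos p) <| by
      rw [mul_card_fiber_of_shift f σ hf, mul_card_fiber_of_shift r τ hr]
  exact ⟨Equiv.ofFiberEquiv e, fun a => Equiv.ofFiberEquiv_map e a⟩

theorem ncard_orbit_dvd {α : Type*} [Finite α] (g : Equiv.Perm α) (a : α) {i : ℤ}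
    (h : (g ^ i) a = a) : ((orbit (Subgroup.zpowers g) a).ncard : ℤ) ∣ i := by
  have := Fintype.ofFinite (orbit (Subgroup.zpowers g) a)
  rw [← Nat.card_coe_set_eq, Nat.card_eq_fintype_card, ← minimalPeriod_eq_card]
  exact zpow_smul_eq_iff_minimalPeriod_dvd.1 h

theorem exists_shift_labelling {α : Type*} [Finite α] (g : Equiv.Perm α) (p : ℕ)
    (hp : ∀ a : α, p ∣ (orbit (Subgroup.zpowers g) a).ncard) :
    ∃ f : α → ZMod p, ∀ a, f (g a) = f a + 1 := by
  let q (a : α) : orbitRel.Quotient (Subgroup.zpowers g) α := Quotient.mk'' a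
  have hrep (a : α) : ∃ i : ℤ, (g ^ i) (q a).out = a := by
    have : a ∈ orbit (Subgroup.zpowers g) (q a).out :=
      (orbitRel (Subgroup.zpowers g) α).symm (Quotient.mk_out a)
    obtain ⟨⟨_, i, rfl⟩, hi⟩ := this
    exact ⟨i, hi⟩
  choose j hj using hrep
  refine ⟨fun a => j a, fun a => ?_⟩
  have hq : q (g a) = q a :=
    Quotient.sound ⟨⟨g, Subgroup.mem_zpowers g⟩, rfl⟩
  have h1 := hj (g a)
  rw [hq] at h1
  have h2 : (g ^ (j (g a) - (j a + 1))) (g a) = g a := by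
    have h3 : (g ^ (j a + 1)) (q a).out = g a := by
      rw [add_comm, zpow_add, zpow_one, Equiv.Perm.mul_apply, hj a]
    conv_lhs => rw [← h3]
    rw [← Equiv.Perm.mul_apply, ← zpow_add, h3, sub_add_cancel, h1]
  have h4 := (Int.natCast_dvd_natCast.2 (hp (g a))).trans (ncard_orbit_dvd g (g a) h2)
  have h5 := (ZMod.intCast_zmod_eq_zero_iff_dvd _ p).2 h4
  push_cast at h5
  exact sub_eq_zero.1 h5

theorem apply_mem_orbit_zpowers_iff {α : Type*} (g : Equiv.Perm α) (a b : α) :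
    g b ∈ orbit (Subgroup.zpowers g) a ↔ b ∈ orbit (Subgroup.zpowers g) a := by
  rw [← orbit_eq_iff, ← orbit_eq_iff]
  exact iff_of_eq <| congrArg (· = _) <|
    orbit_smul (⟨g, Subgroup.mem_zpowers g⟩ : Subgroup.zpowers g) b

/-- A permutation has a short invariant set, or an invariant set of size coprime to the degree
and less than half of it, or all its cycle lengths share a prime divisor with the degree. -/
theorem invariant_set_trichotomy {α : Type*} [Finite α] (hα : 3 ≤ Nat.card α)
    (g : Equiv.Perm α) :
    (∃ s : Set α, (∀ b, g b ∈ s ↔ b ∈ s) ∧ 0 < s.ncard ∧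
      (3 * s.ncard ≤ Nat.card α ∨
        (2 * s.ncard < Nat.card α ∧ (Nat.card α).Coprime s.ncard))) ∨
    ∃ p ∈ (Nat.card α).primeFactors, ∀ a : α, p ∣ (orbit (Subgroup.zpowers g) a).ncard := by
  have : Nonempty α := (Nat.card_pos_iff.1 (by omega)).1
  let O (a : α) : Set α := orbit (Subgroup.zpowers g) a
  have hpos (a : α) : 0 < (O a).ncard := (Set.ncard_pos).2 ⟨a, mem_orbit_self a⟩
  obtain ⟨a, ha⟩ := Finite.exists_min fun a => (O a).ncard
  by_cases h3 : 3 * (O a).ncard ≤ Nat.card α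
  · exact .inl ⟨O a, apply_mem_orbit_zpowers_iff g a, hpos a, .inl h3⟩
  have disj {b c : α} (h : c ∉ O b) : Disjoint (O b) (O c) :=
    (orbit.eq_or_disjoint b c).resolve_left fun e => h (orbit_eq_iff.1 e.symm)
  by_cases hU : ∀ b, b ∈ O a
  · obtain ⟨p, hp, hpn⟩ := Nat.exists_prime_and_dvd (n := Nat.card α) (by omega)
    refine .inr ⟨p, Nat.mem_primeFactors.2 ⟨hp, hpn, by omega⟩, fun b => ?_⟩
    have h1 : O b = Set.univ := by
      rw [show O b = O a from orbit_eq_iff.2 (hU b)]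
      exact Set.eq_univ_of_forall hU
    change p ∣ (O b).ncard
    rwa [h1, Set.ncard_univ]
  push Not at hU
  obtain ⟨b, hb⟩ := hU
  have hab := Set.ncard_union_eq (disj hb)
  have hcover (c : α) : c ∈ O a ∨ c ∈ O b := by
    by_contra! hc
    have h1 := Set.ncard_union_eq
      (Set.disjoint_union_left.2 ⟨disj hc.1, disj hc.2⟩)
    have h2 := Set.ncard_le_card (O a ∪ O b ∪ O c)
    have := ha b
    have := ha c
    omega
  have hsum : (O a).ncard + (O b).ncard = Nat.card α := by
    rw [← hab, Set.eq_univ_of_forall (s := O a ∪ O b) hcover, Set.ncard_univ]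
  by_cases hco : (Nat.card α).Coprime (O a).ncard
  · refine .inl ⟨O a, apply_mem_orbit_zpowers_iff g a, hpos a, .inr ⟨?_, hco⟩⟩
    have h1 := ha b
    rcases (show 2 * (O a).ncard ≤ Nat.card α by omega).lt_or_eq with h | h
    · exact h
    · have := (Nat.coprime_self _).1 (h ▸ hco).coprime_mul_left
      omega
  · obtain ⟨p, hp, hpn, hpa⟩ := Nat.Prime.not_coprime_iff_dvd.1 hco
    refine .inr ⟨p, Nat.mem_primeFactors.2 ⟨hp, hpn, by omega⟩, fun c => ?_⟩
    change p ∣ (O c).ncard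
    rcases hcover c with h | h
    · rwa [show O c = O a from orbit_eq_iff.2 h]
    · rw [show O c = O b from orbit_eq_iff.2 h]
      exact (Nat.dvd_add_right hpa).1 (hsum ▸ hpn)

theorem exists_conj_mem_stabilizer {α : Type*} [Finite α] {s t : Set α}
    (h : s.ncard = t.ncard) {g : Equiv.Perm α} (hg : ∀ b, g b ∈ s ↔ b ∈ s) :
    ∃ x : Equiv.Perm α, x * g * x⁻¹ ∈ stabilizer (Equiv.Perm α) t := by
  classical
  have := Fintype.ofFinite α
  have e : {a // a ∈ s} ≃ {a // a ∈ t} := (Finite.card_eq.1 h).some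
  have hx (a : α) : e.extendSubtype a ∈ t ↔ a ∈ s :=
    ⟨fun ht => by_contra fun hs => e.extendSubtype_not_mem a hs ht, e.extendSubtype_mem a⟩
  refine ⟨e.extendSubtype, mem_stabilizer_set.2 fun a => ?_⟩
  simp only [Equiv.Perm.smul_def, mul_apply, coe_inv]
  rw [hx, hg, ← hx, Equiv.apply_symm_apply]

theorem two_mul_card_coprime_lt_half_le_totient {n : ℕ} (hn : 2 ≤ n) :
    2 * ((Finset.range n).filter fun k => 2 * k < n ∧ n.Coprime k).card ≤ n.totient := by
  set S := (Finset.range n).filter fun k => 2 * k < n ∧ n.Coprime k with hS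
  have hinj : Set.InjOn (fun k => n - k) S := by
    intro a ha b hb hab
    simp only [hS, Finset.coe_filter, Finset.mem_range, Set.mem_ofPred_eq] at ha hb hab
    omega
  have hdisj : Disjoint S (S.image fun k => n - k) := by
    rw [Finset.disjoint_left]
    intro a ha hb
    simp only [hS, Finset.mem_image, Finset.mem_filter, Finset.mem_range] at ha hb
    omega
  calc 2 * S.card = (S ∪ S.image fun k => n - k).card := by
        rw [Finset.card_union_of_disjoint hdisj, Finset.card_image_of_injOn hinj, two_mul]
    _ ≤ n.totient := by
        rw [Nat.totient_eq_card_coprime]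
        refine Finset.card_le_card fun a ha => ?_
        simp only [hS, Finset.mem_union, Finset.mem_image, Finset.mem_filter,
          Finset.mem_range] at ha ⊢
        rcases ha with ⟨h, -, hc⟩ | ⟨k, ⟨h, -, hc⟩, rfl⟩
        · exact ⟨h, hc⟩
        · have hk : 0 < k := Nat.pos_of_ne_zero fun h0 => by
            rw [h0, Nat.coprime_zero_right] at hc
            omega
          exact ⟨by omega, (Nat.coprime_self_sub_right h.le).2 hc⟩

theorem gamma_sym_upper_bound (n : ℕ) (hn : 3 ≤ n) (hnp : ¬ n.Prime) :
    (normalCoveringNumber (Equiv.Perm (Fin n)) : ℝ) ≤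
      (n : ℝ) / 3 + (Nat.totient n : ℝ) / 2 + (n.primeFactors.card : ℝ) := by
  classical
  have : NeZero n := ⟨by omega⟩
  let S := (Finset.range n).filter fun k => 2 * k < n ∧ n.Coprime k
  let K := Finset.Icc 1 (n / 3) ∪ S
  have hK {k : ℕ} (hk : k ∈ K) : 0 < k ∧ k < n := by
    simp only [K, S, Finset.mem_union, Finset.mem_Icc, Finset.mem_filter, Finset.mem_range] at hk
    rcases hk with hk | ⟨hk, -, hc⟩
    · omega
    · refine ⟨Nat.pos_of_ne_zero ?_, hk⟩
      rintro rfl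
      rw [Nat.coprime_zero_right] at hc
      omega
  let t (k : ℕ) : Set (Fin n) := {i | i.val < k}
  have ht {k : ℕ} (hk : k < n) : (t k).ncard = k := by
    have : t k = Set.Iio ⟨k, hk⟩ := rfl
    rw [this, Set.ncard_eq_toFinset_card']
    simp
  let r (p : ℕ) (i : Fin n) : ZMod p := (i.val : ZMod p)
  let H : K ⊕ n.primeFactors → Subgroup (Equiv.Perm (Fin n)) :=
    Sum.elim (fun k => stabilizer _ (t k)) fun p => translationSubgroup (r p)
  have hH (i) : H i ≠ ⊤ := by
    rcases i with ⟨k, hk⟩ | ⟨p, hp⟩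
    · obtain ⟨h0, h1⟩ := hK hk
      exact stabilizer_ne_top_of_nonempty_of_nonempty_compl ⟨⟨0, by omega⟩, h0⟩
        ⟨⟨k, h1⟩, lt_irrefl k⟩
    · have : Fact p.Prime := ⟨Nat.prime_of_mem_primeFactors hp⟩
      exact translationSubgroup_ne_top (a := (⟨0, by omega⟩ : Fin n)) (b := ⟨1, by omega⟩)
        (c := ⟨2, by omega⟩) (by simp [r]) (by simp) (by simp)
  have hcov (g : Equiv.Perm (Fin n)) : ∃ i, ∃ x, x * g * x⁻¹ ∈ H i := by
    rcases invariant_set_trichotomy (by simpa using hn) g with ⟨s, hs, h0, h⟩ | ⟨p, hp, h⟩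
    · rw [Nat.card_fin] at h
      have hk : s.ncard ∈ K := by
        simp only [K, S, Finset.mem_union, Finset.mem_Icc, Finset.mem_filter, Finset.mem_range]
        rcases h with h | ⟨h, hc⟩
        · left; omega
        · exact .inr ⟨by omega, h, hc⟩
      exact ⟨.inl ⟨_, hk⟩, exists_conj_mem_stabilizer (ht (hK hk).2).symm hs⟩
    · rw [Nat.card_fin] at hp
      have : NeZero p := ⟨(Nat.prime_of_mem_primeFactors hp).ne_zero⟩
      obtain ⟨f, hf⟩ := exists_shift_labelling g p h
      have hr (i : Fin n) : r p (Equiv.addRight 1 i) = r p i + 1 := by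
        simp only [r, Equiv.coe_addRight, Fin.val_add, Fin.val_one']
        rw [Nat.add_mod_mod, ← Nat.cast_succ, ZMod.natCast_eq_natCast_iff]
        exact (Nat.mod_modEq _ n).of_dvd (Nat.dvd_of_mem_primeFactors hp)
      obtain ⟨x, hx⟩ := exists_perm_comp_eq f (r p) g _ hf hr
      refine ⟨.inr ⟨p, hp⟩, x, 1, fun a => ?_⟩
      simp only [mul_apply, coe_inv]
      rw [hx, hf, ← hx, Equiv.apply_symm_apply]
  have h1 := normalCoveringNumber_le_card H hH hcov
  have h2 : Fintype.card (K ⊕ n.primeFactors) ≤ n / 3 + S.card + n.primeFactors.card := by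
    simpa [K] using Finset.card_union_le (Finset.Icc 1 (n / 3)) S
  have h3 : 2 * S.card ≤ n.totient := two_mul_card_coprime_lt_half_le_totient (by omega)
  have h4 : ((n / 3 : ℕ) : ℝ) ≤ (n : ℝ) / 3 := Nat.cast_div_le
  have h5 : (normalCoveringNumber (Equiv.Perm (Fin n)) : ℝ) ≤
      (n / 3 : ℕ) + S.card + n.primeFactors.card := mod_cast h1.trans h2
  have h6 : 2 * (S.card : ℝ) ≤ n.totient := mod_cast h3
  linarith
end
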